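/- Let α be a cascading n-sequence with lower-subinterval decomposition I_1, ..., I_P, and suppose α satisfies the Lyndon property for every letter l'' <= l. Let I_k be a lower subinterval of α with head j = min(I_k) <= l and maximum m = max(I_k). Then there is a single column index c such that, for every l' with j <= l' <= min(m, l), the application of f_{I_k} to R_{k-1} adds a box to column c of the l'-th partition, and this box has height l' - j + 1 (that is, the operator f_{l'} occurring in I_k replaces a string of length c - 1 by one of length c, and the resulting l'-th partition has exactly l' - j + 1 strings of length at least c). -/

import Mathlib

namespace CascRC

abbrev RP := Multiset (ℕ × ℤ)
abbrev RC := ℕ → RP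

/-- The Cartan matrix of type `A`. -/
def cartanA (a b : ℕ) : ℤ :=
  if a = b then 2 else if b = a + 1 ∨ a = b + 1 then -1 else 0

/-- The smallest rigging of a rigged partition (0 if empty). -/
noncomputable def minRig (ν : RP) : ℤ :=
  if h : ν = 0 then 0
  else (ν.map Prod.snd).toFinset.min'
    (Multiset.toFinset_nonempty.mpr (by simpa [Multiset.map_eq_zero] using h))

/-- The greatest length of a string whose rigging is the smallest rigging. -/
noncomputable def selLen (ν : RP) : ℕ :=
  ((ν.filter (fun s => s.2 = minRig ν)).map Prod.fst).sup

/-- The Kashiwara operator `f_a` on rigged configurations. -/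
noncomputable def fOp (a : ℕ) (R : RC) : RC :=
  if R a = 0 ∨ 0 < minRig (R a) then
    fun b => (if b = a then ({(1, -1)} : RP) else 0)
      + (R b).map (fun s => if 0 < s.1 then (s.1, s.2 - cartanA a b) else s)
  else
    fun b =>
      (if b = a then ({(selLen (R a) + 1, minRig (R a) - 1)} : RP) else 0)
      + ((if b = a then (R a).erase (selLen (R a), minRig (R a)) else R b).map
          (fun s => if selLen (R a) < s.1 then (s.1, s.2 - cartanA a b) else s))

/-- A list `γ` acts by `f_γ = f_{γ_p} ∘ ⋯ ∘ f_{γ₁}`. -/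
noncomputable def fList (γ : List ℕ) (R : RC) : RC :=
  γ.foldl (fun S a => fOp a S) R

def emptyRC : RC := fun _ => 0

/-- `RC(α)`: the result of the list `α` acting on the empty rigged configuration. -/
noncomputable def RCseq (α : List ℕ) : RC := fList α emptyRC

/-- The `m`-lower subinterval `(a, a+1, …, m)`. -/
def lowerInt (a m : ℕ) : List ℕ := List.range' a (m + 1 - a)

def IsLowerIv (n : ℕ) (p : ℕ × ℕ) : Prop := 1 ≤ p.1 ∧ p.1 ≤ p.2 ∧ p.2 ≤ n

/-- Ordering between consecutive lower subintervals in a cascading sequence. -/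
def CascCh (p q : ℕ × ℕ) : Prop := q.2 < p.2 ∨ (q.2 = p.2 ∧ p.1 ≤ q.1)

/-- `ivs` is the lower-subinterval decomposition of a cascading `n`-sequence. -/
def IsCascDecomp (n : ℕ) (ivs : List (ℕ × ℕ)) : Prop :=
  (∀ p ∈ ivs, IsLowerIv n p) ∧ ivs.Chain' CascCh

/-- The integer sequence determined by a decomposition into lower subintervals. -/
def seqOf (ivs : List (ℕ × ℕ)) : List ℕ :=
  (ivs.map (fun p => lowerInt p.1 p.2)).flatten

/-- `R_k`: the rigged configuration corresponding to `I_1 ⋯ I_k`. -/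
noncomputable def Rk (ivs : List (ℕ × ℕ)) (k : ℕ) : RC :=
  RCseq (seqOf (ivs.take k))

/-- Height of column `c` of (the underlying partition of) a rigged partition. -/
def colHt (ν : RP) (c : ℕ) : ℕ := (ν.filter (fun s => c ≤ s.1)).card

/-- Length of the `i`-th row (1-based) of the underlying partition. -/
def rowLen (ν : RP) (i : ℕ) : ℕ :=
  ((Finset.Icc 1 ((ν.map Prod.fst).sup)).filter (fun c => i ≤ colHt ν c)).card

/-- Length of the uppermost row of length at most `L` (0 for the virtual empty row). -/
def upRowLen (ν : RP) (L : ℕ) : ℕ := rowLen ν (colHt ν (L + 1) + 1)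

/-- The column to which an application of `f_a` adds a box. -/
noncomputable def selCol (a : ℕ) (R : RC) : ℕ :=
  if R a = 0 ∨ 0 < minRig (R a) then 1 else selLen (R a) + 1

/-- Given a lower subinterval `p = (a, m)` acting on `R`, the column to which the
operator `f_l` occurring in it adds a box in the `l`-th partition. -/
noncomputable def ivCol (p : ℕ × ℕ) (l : ℕ) (R : RC) : ℕ :=
  selCol l (fList (lowerInt p.1 (l - 1)) R)

/-- Lengths `|r_a|, |r_{a+1}|, …` of the rows `r_i` of Lemma "snake":
`rLenSeq R a (i - a) = |r_i|`. -/
def rLenSeq (R : RC) (a : ℕ) : ℕ → ℕ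
  | 0 => rowLen (R a) 1
  | k + 1 => upRowLen (R (a + k + 1)) (rLenSeq R a k)


/-- `α` (with decomposition `ivs`) satisfies the Lyndon property for the letter `l`:
every initial segment contains at least as many lower subintervals with head `l` as
with head `j`, for every `j < l`. -/
def LyndonProp (ivs : List (ℕ × ℕ)) (l : ℕ) : Prop :=
  ∀ i, i ≤ ivs.length → ∀ j, j < l →
    ((ivs.take i).countP (fun p => decide (p.1 = j)))
      ≤ ((ivs.take i).countP (fun p => decide (p.1 = l)))

/-! ### Minimal rigging and the string selected by `f_a` -/

lemma minRig_le {ν : RP} {s : ℕ × ℤ} (hs : s ∈ ν) : minRig ν ≤ s.2 := by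
  have h : ν ≠ 0 := by rintro rfl; simp at hs
  rw [minRig, dif_neg h]
  exact Finset.min'_le _ _ (by simpa using ⟨s.1, hs⟩)

lemma exists_minRig {ν : RP} (h : ν ≠ 0) : ∃ s ∈ ν, s.2 = minRig ν := by
  have key := Finset.min'_mem (ν.map Prod.snd).toFinset
    (Multiset.toFinset_nonempty.mpr (by simpa [Multiset.map_eq_zero] using h))
  rw [minRig, dif_neg h]
  rw [Multiset.mem_toFinset, Multiset.mem_map] at key
  exact key

/-- `Selects ν L x`: the operator `f_a` lengthens a string of length `L` and rigging `x` of
the `a`-th partition `ν`; a new string counts as a lengthening of the virtual string `(0, 0)`. -/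
def Selects (ν : RP) (L : ℕ) (x : ℤ) : Prop :=
  (L = 0 ∧ x = 0 ∧ ∀ s ∈ ν, 0 < s.2) ∨
    ((L, x) ∈ ν ∧ x ≤ 0 ∧ ∀ s ∈ ν, x ≤ s.2 ∧ (s.2 = x → s.1 ≤ L))

lemma empty_or_minRig_pos {ν : RP} (h : ∀ s ∈ ν, 0 < s.2) : ν = 0 ∨ 0 < minRig ν := by
  by_cases h0 : ν = 0
  · exact Or.inl h0
  · obtain ⟨s, hs, hx⟩ := exists_minRig h0
    exact Or.inr (hx ▸ h s hs)

lemma Selects.minRig_eq {ν : RP} {L : ℕ} {x : ℤ} (hL : (L, x) ∈ ν)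
    (h : ∀ s ∈ ν, x ≤ s.2 ∧ (s.2 = x → s.1 ≤ L)) : minRig ν = x := by
  have h0 : ν ≠ 0 := by rintro rfl; simp at hL
  obtain ⟨s, hs, hx⟩ := exists_minRig h0
  exact le_antisymm (minRig_le hL) (hx ▸ (h s hs).1)

lemma Selects.selLen_eq {ν : RP} {L : ℕ} {x : ℤ} (hL : (L, x) ∈ ν)
    (h : ∀ s ∈ ν, x ≤ s.2 ∧ (s.2 = x → s.1 ≤ L)) : selLen ν = L := by
  rw [selLen, Selects.minRig_eq hL h]
  apply le_antisymm
  · rw [Multiset.sup_le]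
    intro b hb
    obtain ⟨s, hs, rfl⟩ := Multiset.mem_map.mp hb
    rw [Multiset.mem_filter] at hs
    exact (h s hs.1).2 hs.2
  · apply Multiset.le_sup
    exact Multiset.mem_map.mpr ⟨(L, x), Multiset.mem_filter.mpr ⟨hL, rfl⟩, rfl⟩

/-- Subtract `d` from the rigging of a string longer than `L`. -/
def shiftRig (L : ℕ) (d : ℤ) (s : ℕ × ℤ) : ℕ × ℤ :=
  if L < s.1 then (s.1, s.2 - d) else s

@[simp] lemma shiftRig_fst (L : ℕ) (d : ℤ) (s : ℕ × ℤ) : (shiftRig L d s).1 = s.1 := by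
  unfold shiftRig; split_ifs <;> rfl

lemma shiftRig_snd (L : ℕ) (d : ℤ) (s : ℕ × ℤ) :
    (shiftRig L d s).2 = s.2 - if L < s.1 then d else 0 := by
  unfold shiftRig; split_ifs <;> simp

lemma Selects.selCol_eq {a : ℕ} {R : RC} {L : ℕ} {x : ℤ} (h : Selects (R a) L x) :
    selCol a R = L + 1 := by
  rcases h with ⟨rfl, rfl, h⟩ | ⟨hL, hx, h⟩
  · rw [selCol, if_pos (empty_or_minRig_pos h)]
  · have h0 : R a ≠ 0 := by intro h0; simp [h0] at hL
    rw [selCol, if_neg, Selects.selLen_eq hL h]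
    rw [Selects.minRig_eq hL h]
    push Not
    exact ⟨h0, hx⟩

lemma Selects.fOp_self {a : ℕ} {R : RC} {L : ℕ} {x : ℤ} (h : Selects (R a) L x) :
    fOp a R a = (L + 1, x - 1) ::ₘ ((R a).erase (L, x)).map (shiftRig L (cartanA a a)) := by
  rcases h with ⟨rfl, rfl, h⟩ | ⟨hL, hx, h⟩
  · have h0 : ((0, 0) : ℕ × ℤ) ∉ R a := fun h' => lt_irrefl _ (h _ h')
    rw [fOp, if_pos (empty_or_minRig_pos h), Multiset.erase_of_notMem h0]
    simp [Multiset.singleton_add]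
    rfl
  · have h0 : R a ≠ 0 := by intro h0; simp [h0] at hL
    rw [fOp, if_neg, Selects.selLen_eq hL h, Selects.minRig_eq hL h]
    · simp [Multiset.singleton_add]
      rfl
    · rw [Selects.minRig_eq hL h]
      push Not
      exact ⟨h0, hx⟩

lemma Selects.fOp_of_ne {a b : ℕ} {R : RC} {L : ℕ} {x : ℤ} (h : Selects (R a) L x)
    (hb : b ≠ a) : fOp a R b = (R b).map (shiftRig L (cartanA a b)) := by
  rcases h with ⟨rfl, rfl, h⟩ | ⟨hL, hx, h⟩
  · rw [fOp, if_pos (empty_or_minRig_pos h)]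
    simp [hb]
    rfl
  · have h0 : R a ≠ 0 := by intro h0; simp [h0] at hL
    rw [fOp, if_neg, Selects.selLen_eq hL h]
    · simp [hb]
      rfl
    · rw [Selects.minRig_eq hL h]
      push Not
      exact ⟨h0, hx⟩

/-- Every string of `f_a R` is the lengthened string or a shifted string of `R`. -/
lemma Selects.mem_fOp {a b : ℕ} {R : RC} {L : ℕ} {x : ℤ} (h : Selects (R a) L x)
    {s : ℕ × ℤ} (hs : s ∈ fOp a R b) :
    (b = a ∧ s = (L + 1, x - 1)) ∨ ∃ t ∈ R b, s = shiftRig L (cartanA a b) t := by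
  by_cases hb : b = a
  · subst hb
    rw [h.fOp_self, Multiset.mem_cons, Multiset.mem_map] at hs
    rcases hs with hs | ⟨t, ht, rfl⟩
    · exact Or.inl ⟨rfl, hs⟩
    · exact Or.inr ⟨t, Multiset.mem_of_mem_erase ht, rfl⟩
  · rw [h.fOp_of_ne hb, Multiset.mem_map] at hs
    obtain ⟨t, ht, rfl⟩ := hs
    exact Or.inr ⟨t, ht, rfl⟩

/-! ### Column heights -/

lemma colHt_cons (s : ℕ × ℤ) (ν : RP) (c : ℕ) :
    colHt (s ::ₘ ν) c = (if c ≤ s.1 then 1 else 0) + colHt ν c := by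
  unfold colHt
  split_ifs with h
  · rw [Multiset.filter_cons_of_pos (p := fun s : ℕ × ℤ => c ≤ s.1) ν h, Multiset.card_cons,
      add_comm]
  · rw [Multiset.filter_cons_of_neg (p := fun s : ℕ × ℤ => c ≤ s.1) ν h, zero_add]

lemma colHt_map_shiftRig (ν : RP) (L : ℕ) (d : ℤ) (c : ℕ) :
    colHt (ν.map (shiftRig L d)) c = colHt ν c := by
  induction ν using Multiset.induction_on with
  | empty => simp
  | cons s ν ih => rw [Multiset.map_cons, colHt_cons, colHt_cons, ih, shiftRig_fst]

lemma colHt_antitone (ν : RP) : Antitone (colHt ν) := fun _ _ h =>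
  Multiset.card_le_card (Multiset.monotone_filter_right ν fun _ hs => h.trans hs)

lemma colHt_eq_zero {ν : RP} {c : ℕ} : colHt ν c = 0 ↔ ∀ s ∈ ν, s.1 < c := by
  simp [colHt, Multiset.filter_eq_nil]

lemma colHt_congr {ν : RP} {c d : ℕ} (h : ∀ s ∈ ν, c ≤ s.1 ↔ d ≤ s.1) :
    colHt ν c = colHt ν d := by
  unfold colHt
  rw [Multiset.filter_congr h]

/-- A string of length `≥ c` but not `≥ d` makes column `c` higher than column `d`. -/
lemma colHt_lt_of_mem {ν : RP} {s : ℕ × ℤ} (hs : s ∈ ν) {c d : ℕ} (hc : c ≤ s.1)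
    (hd : s.1 < d) : colHt ν d < colHt ν c := by
  obtain ⟨t, rfl⟩ := Multiset.exists_cons_of_mem hs
  have := colHt_antitone t (hc.trans hd.le)
  rw [colHt_cons, colHt_cons, if_pos hc, if_neg (by omega)]
  omega

lemma exists_mem_of_colHt_lt {ν : RP} {c : ℕ} (h : colHt ν (c + 1) < colHt ν c) :
    ∃ s ∈ ν, s.1 = c := by
  by_contra! hne
  exact h.ne (colHt_congr fun s hs => by have := hne s hs; omega)

lemma Selects.colHt_fOp {a : ℕ} {R : RC} {L : ℕ} {x : ℤ} (h : Selects (R a) L x)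
    (b : ℕ) {c : ℕ} (hc : 1 ≤ c) :
    colHt (fOp a R b) c = colHt (R b) c + if b = a ∧ c = L + 1 then 1 else 0 := by
  by_cases hb : b = a
  · subst hb
    rw [h.fOp_self, colHt_cons, colHt_map_shiftRig]
    rcases h with ⟨rfl, rfl, h⟩ | ⟨hL, -, -⟩
    · have h0 : ((0, 0) : ℕ × ℤ) ∉ R b := fun h' => lt_irrefl _ (h _ h')
      rw [Multiset.erase_of_notMem h0]
      have : c ≤ 0 + 1 ↔ c = 0 + 1 := by omega
      simp only [this, true_and]
      ring
    · obtain ⟨t, ht⟩ := Multiset.exists_cons_of_mem hL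
      rw [ht, Multiset.erase_cons_head, colHt_cons]
      simp only [true_and]
      split_ifs <;> omega
  · rw [h.fOp_of_ne hb, colHt_map_shiftRig]
    simp [hb]

/-! ### The state in the middle of the action of a lower subinterval -/

/-- If the riggings of `ν` are `-k` on the strings longer than `M`, raised by one beyond
length `P`, and lie in `(-k, 0]` on the others, then the longest string of length
at most `P` is selected. -/
lemma exists_selects {ν : RP} {P k M : ℕ}
    (hν : ∀ s ∈ ν, (M < s.1 → s.2 = -(k : ℤ) + if P < s.1 then 1 else 0) ∧
      (s.1 ≤ M → -(k : ℤ) < s.2 ∧ s.2 ≤ 0))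
    (hk : 0 < k → M < P ∧ ∃ s ∈ ν, s.1 = M + 1) :
    ∃ L, Selects ν L (-(k : ℤ)) ∧ L ≤ P ∧ (∀ s ∈ ν, s.1 ≤ P → s.1 ≤ L) ∧
      (0 < k → M < L) ∧ (L = 0 ∨ ∃ s ∈ ν, s.1 = L) := by
  by_cases hex : ∃ s ∈ ν, s.1 ≤ P
  · obtain ⟨t, ht, hmax⟩ := Finset.exists_max_image (ν.toFinset.filter fun s => s.1 ≤ P)
      Prod.fst (by
        obtain ⟨s, hs, hsP⟩ := hex
        exact ⟨s, by simp [hs, hsP]⟩)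
    simp only [Finset.mem_filter, Multiset.mem_toFinset, and_imp] at ht hmax
    have hMt : 0 < k → M < t.1 := fun hk0 => by
      obtain ⟨hMP, s, hs, hsM⟩ := hk hk0
      have := hmax s hs (by omega)
      omega
    have hMt' : M < t.1 := by
      by_contra hcon
      have := (hν t ht.1).2 (by omega)
      rcases Nat.eq_zero_or_pos k with rfl | hk0
      · simp at this; omega
      · exact hcon (hMt hk0)
    have ht2 : t.2 = -(k : ℤ) := by
      rw [(hν t ht.1).1 hMt', if_neg (by omega), add_zero]
    refine ⟨t.1, Or.inr ⟨?_, by omega, fun s hs => ?_⟩, ht.2, hmax, hMt, Or.inr ⟨t, ht.1, rfl⟩⟩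
    · rw [← ht2]; exact ht.1
    · have h1 := (hν s hs).1
      have h2 := (hν s hs).2
      have h3 := hmax s hs
      by_cases hsM : M < s.1
      · have h1 := h1 hsM
        split_ifs at h1 with hP <;> omega
      · have := h2 (by omega)
        omega
  · push Not at hex
    have hk0 : k = 0 := by
      by_contra hne
      obtain ⟨hMP, s, hs, hsM⟩ := hk (by omega)
      have := hex s hs
      omega
    subst hk0
    refine ⟨0, Or.inl ⟨rfl, by simp, fun s hs => ?_⟩, Nat.zero_le _, fun s hs h => ?_,
      fun h => h.false.elim, Or.inl rfl⟩
    · have h1 := hν s hs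
      rw [if_pos (hex s hs)] at h1
      by_cases hsM : M < s.1
      · have := h1.1 hsM; simp at this; omega
      · have := h1.2 (by omega); simp at this; omega
    · exact absurd h (by have := hex s hs; omega)

/-- The configuration `T` just before `f_b` acts as part of a lower subinterval with
maximum `m`, where `f_{b-1}` has just lengthened a string of length `P` (`P` is large if `b` is
the head), `k` earlier lower subintervals had maximum `m`, and the last of
these lengthened strings of length `D i` in the partitions `i`. -/
structure MidState (m b P k : ℕ) (D : ℕ → ℕ) (T : RC) : Prop where
  pos : ∀ i, ∀ s ∈ T i, 1 ≤ s.1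
  rig : ∀ i < m, ∀ s ∈ T i, s.2 =
    (if i + 1 = b ∧ P < s.1 then -1 else 0) + (if i = b ∧ P < s.1 then 1 else 0)
  interlace : ∀ i < m, ∀ c, 1 ≤ c →
    colHt (T i) c ≤ colHt (T (i + 1)) c + (if i + 1 = b ∧ c = P + 1 then 1 else 0) ∧
    colHt (T (i + 1)) c + (if i + 1 = b ∧ c = P + 1 then 1 else 0) ≤ colHt (T i) c + 1
  top : b ≤ m → ∀ s ∈ T m,
    (D m < s.1 → s.2 = -(k : ℤ) + if b = m ∧ P < s.1 then 1 else 0) ∧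
    (s.1 ≤ D m → -(k : ℤ) < s.2 ∧ s.2 ≤ 0)
  prev : b ≤ m → 0 < k →
    (∀ i, b ≤ i → i ≤ m → colHt (T i) (D i + 2) < colHt (T i) (D i + 1)) ∧
    (∀ i, b ≤ i → i < m → D (i + 1) ≤ D i) ∧ D b < P

/-- No string of the partition before `b` has a length that `f_b` skips. -/
lemma MidState.no_mem_gap {m b P k : ℕ} {D : ℕ → ℕ} {T : RC} (h : MidState m b P k D T)
    {i L : ℕ} (hi : i + 1 = b) (hb : b ≤ m)
    (hgap : ∀ s ∈ T b, s.1 ≤ P → s.1 ≤ L) {s : ℕ × ℤ} (hs : s ∈ T i) (hsP : s.1 ≤ P) :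
    s.1 ≤ L := by
  by_contra hcon
  subst hi
  have h1 := (h.interlace i (by omega) (L + 1) (by omega)).1
  have h2 := (h.interlace i (by omega) (P + 1) (by omega)).2
  have h3 : colHt (T (i + 1)) (L + 1) = colHt (T (i + 1)) (P + 1) :=
    colHt_congr fun t ht => by have := hgap t ht; omega
  have h4 := colHt_lt_of_mem hs (c := L + 1) (d := P + 1) (by omega) (by omega)
  rw [if_neg (by omega)] at h1
  rw [if_pos ⟨rfl, rfl⟩] at h2
  omega

lemma cartanA_self (a : ℕ) : cartanA a a = 2 := by simp [cartanA]

lemma cartanA_succ_left (a : ℕ) : cartanA (a + 1) a = -1 := by simp [cartanA]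

lemma cartanA_succ_right (a : ℕ) : cartanA a (a + 1) = -1 := by simp [cartanA]

lemma cartanA_of_far {a b : ℕ} (h1 : a ≠ b) (h2 : b ≠ a + 1) (h3 : a ≠ b + 1) :
    cartanA a b = 0 := by simp [cartanA, h1, h2, h3]

/-- The operator `f_b` selects in a `MidState` the longest string of length at most `P`. -/
lemma MidState.exists_selects {m b P k : ℕ} {D : ℕ → ℕ} {T : RC} (h : MidState m b P k D T)
    (hb : b ≤ m) :
    ∃ L x, Selects (T b) L x ∧ L ≤ P ∧ (∀ s ∈ T b, s.1 ≤ P → s.1 ≤ L) ∧ (0 < k → D b < L) ∧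
      (L = 0 ∨ ∃ s ∈ T b, s.1 = L) ∧ x = if b = m then -(k : ℤ) else 0 := by
  have hprev : 0 < k → D b < P ∧ ∃ s ∈ T b, s.1 = D b + 1 := fun hk =>
    ⟨(h.prev hb hk).2.2, exists_mem_of_colHt_lt ((h.prev hb hk).1 b le_rfl hb)⟩
  by_cases hbm : b = m
  · obtain ⟨L, hL⟩ := CascRC.exists_selects (ν := T b) (P := P) (k := k) (M := D b)
      (by
        intro s hs
        have := h.top hb s (hbm ▸ hs)
        simpa [hbm] using this) hprev
    exact ⟨L, _, hL.1, hL.2.1, hL.2.2.1, hL.2.2.2.1, hL.2.2.2.2, by rw [if_pos hbm]⟩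
  · obtain ⟨L, hsel, hLP, hgap, -, hex⟩ :=
      CascRC.exists_selects (ν := T b) (P := P) (k := 0) (M := 0)
      (by
        intro s hs
        have h1 := h.rig b (by omega) s hs
        have h2 := h.pos b s hs
        refine ⟨fun _ => ?_, fun h3 => by omega⟩
        simpa using h1) (fun hk => hk.false.elim)
    refine ⟨L, _, hsel, hLP, hgap, fun hk => ?_, hex, by rw [if_neg hbm]; simp⟩
    obtain ⟨hDP, s, hs, hsD⟩ := hprev hk
    have := hgap s hs (by omega)
    omega

lemma MidState.step {m b P k : ℕ} {D : ℕ → ℕ} {T : RC} (h : MidState m b P k D T)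
    (hb : b ≤ m) {L : ℕ} {x : ℤ} (hsel : Selects (T b) L x) (hLP : L ≤ P)
    (hgap : ∀ s ∈ T b, s.1 ≤ P → s.1 ≤ L) (hDL : 0 < k → D b < L)
    (hx : x = if b = m then -(k : ℤ) else 0) :
    MidState m (b + 1) L k D (fOp b T) where
  pos := by
    intro i s hs
    rcases hsel.mem_fOp hs with ⟨-, rfl⟩ | ⟨t, ht, rfl⟩
    · simp
    · simpa using h.pos i t ht
  rig := by
    intro i hi s hs
    rcases hsel.mem_fOp hs with ⟨rfl, rfl⟩ | ⟨t, ht, rfl⟩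
    · simp [hx, hi.ne]
    · have h1 := h.rig i hi t ht
      rw [shiftRig_fst, shiftRig_snd, h1]
      by_cases hib : i = b
      · subst hib
        have := hgap t ht
        rw [cartanA_self]
        split_ifs <;> omega
      · by_cases hib1 : i = b + 1
        · subst hib1
          rw [cartanA_succ_right]
          split_ifs <;> omega
        · by_cases hib2 : i + 1 = b
          · have := h.no_mem_gap hib2 hb hgap ht
            subst hib2
            rw [cartanA_succ_left]
            split_ifs <;> omega
          · rw [cartanA_of_far (by omega) (by omega) (by omega)]
            split_ifs <;> omega
  interlace := by
    intro i hi c hc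
    have h1 := h.interlace i hi c hc
    rw [hsel.colHt_fOp i hc, hsel.colHt_fOp (i + 1) hc]
    by_cases hib : i + 1 = b
    · have hP := h.interlace i hi (P + 1) (by omega)
      subst hib
      have hgapc : ∀ d, L < d → d ≤ P + 1 →
          colHt (T (i + 1)) d = colHt (T (i + 1)) (P + 1) := fun d hd hdP =>
        colHt_congr fun t ht => by have := hgap t ht; omega
      rw [if_pos ⟨rfl, rfl⟩] at hP
      rw [if_neg (by omega), if_neg (show ¬(i + 1 = i + 1 + 1 ∧ c = L + 1) by omega)]
      rcases hLP.eq_or_lt with rfl | hLP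
      · split_ifs at h1 ⊢ <;> omega
      · by_cases hcP : c = P + 1
        · subst hcP
          have h2 := h.interlace i hi P (by omega)
          have h3 := hgapc P hLP (by omega)
          have h4 := colHt_antitone (T i) (Nat.le_succ P)
          simp only [Nat.succ_eq_add_one] at h4
          split_ifs at * <;> omega
        · by_cases hcL : c = L + 1
          · subst hcL
            have h3 := hgapc (L + 1) (by omega) (by omega)
            have h4 := colHt_antitone (T i) (show L + 1 ≤ P + 1 by omega)
            split_ifs at * <;> omega
          · split_ifs at * <;> omega
    · split_ifs at * <;> omega
  top := by
    intro hbm s hs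
    rcases hsel.mem_fOp hs with ⟨hmb, -⟩ | ⟨t, ht, rfl⟩
    · omega
    · have h1 := h.top hb t ht
      rw [shiftRig_fst, shiftRig_snd]
      by_cases hbm' : b + 1 = m
      · subst hbm'
        rw [cartanA_succ_right]
        have hD : 0 < k → D (b + 1) < L := fun hk =>
          lt_of_le_of_lt ((h.prev hb hk).2.1 b le_rfl (by omega)) (hDL hk)
        refine ⟨fun hlt => ?_, fun hle => ?_⟩
        · have := h1.1 hlt
          split_ifs at * <;> omega
        · have := h1.2 hle
          split_ifs <;> omega
      · rw [cartanA_of_far (by omega) (by omega) (by omega)]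
        refine ⟨fun hlt => ?_, fun hle => ?_⟩
        · have := h1.1 hlt
          split_ifs at * <;> omega
        · have := h1.2 hle
          split_ifs <;> omega
  prev := by
    intro hbm hk
    obtain ⟨h1, h2, h3⟩ := h.prev hb hk
    refine ⟨fun i hi him => ?_, fun i hi him => h2 i (by omega) him, ?_⟩
    · rw [hsel.colHt_fOp i (by omega), hsel.colHt_fOp i (by omega), if_neg (by omega),
        if_neg (by omega)]
      exact h1 i (by omega) him
    · exact lt_of_le_of_lt (h2 b le_rfl (by omega)) (hDL hk)

/-- The riggings of the `m`-th partition after the last operator `f_m`. -/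
lemma MidState.top_step {m P k : ℕ} {D : ℕ → ℕ} {T : RC} (h : MidState m m P k D T)
    {L : ℕ} (hsel : Selects (T m) L (-(k : ℤ))) (hLP : L ≤ P)
    (hgap : ∀ s ∈ T m, s.1 ≤ P → s.1 ≤ L) (hDL : 0 < k → D m < L) :
    ∀ s ∈ fOp m T m, (L < s.1 → s.2 = -((k + 1 : ℕ) : ℤ)) ∧
      (s.1 ≤ L → -((k + 1 : ℕ) : ℤ) < s.2 ∧ s.2 ≤ 0) := by
  intro s hs
  rcases hsel.mem_fOp hs with ⟨-, rfl⟩ | ⟨t, ht, rfl⟩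
  · constructor
    · intro _; push_cast; ring
    · intro h'; simp at h'
  · have h1 := h.top le_rfl t ht
    have h2 := hgap t ht
    rw [shiftRig_fst, shiftRig_snd, cartanA_self]
    push_cast
    by_cases hD : D m < t.1
    · have := h1.1 hD
      constructor <;> intro _ <;> split_ifs at * <;> omega
    · have := h1.2 (by omega)
      constructor <;> intro _ <;> split_ifs at * <;> omega

/-! ### The action of a whole lower subinterval -/

/-- The properties of `R_{k-1}` that the action of a lower subinterval `(a, …, m)` relies on. -/
structure Ready (a m : ℕ) (R : RC) : Prop where
  pos : ∀ i, ∀ s ∈ R i, 1 ≤ s.1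
  rig : ∀ i < m, ∀ s ∈ R i, s.2 = 0
  interlace : ∀ i < m, ∀ c, 1 ≤ c →
    colHt (R i) c ≤ colHt (R (i + 1)) c ∧ colHt (R (i + 1)) c ≤ colHt (R i) c + 1
  top : ∃ (k : ℕ) (D : ℕ → ℕ),
    (∀ s ∈ R m, (D m < s.1 → s.2 = -(k : ℤ)) ∧ (s.1 ≤ D m → -(k : ℤ) < s.2 ∧ s.2 ≤ 0)) ∧
    (0 < k → (∀ i, a ≤ i → i ≤ m → colHt (R i) (D i + 2) < colHt (R i) (D i + 1)) ∧
      ∀ i, a ≤ i → i < m → D (i + 1) ≤ D i)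

lemma ready_emptyRC (a m : ℕ) : Ready a m emptyRC where
  pos := by simp [emptyRC]
  rig := by simp [emptyRC]
  interlace := by simp [emptyRC]
  top := ⟨0, fun _ => 0, by simp [emptyRC]⟩

lemma Ready.exists_midState {a m : ℕ} {R : RC} (h : Ready a m R) (ha : 1 ≤ a) (ham : a ≤ m) :
    ∃ k D P, MidState m a P k D R ∧ (∀ s ∈ R a, s.1 ≤ P) := by
  obtain ⟨k, D, htop, hprev⟩ := h.top
  obtain ⟨a, rfl⟩ : ∃ a', a = a' + 1 := ⟨a - 1, by omega⟩
  have hbound : ∀ i, ∃ B, ∀ s ∈ R i, s.1 ≤ B := fun i =>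
    ⟨((R i).map Prod.fst).sup, fun s hs => Multiset.le_sup (Multiset.mem_map_of_mem _ hs)⟩
  choose B hB using hbound
  have hP : ∀ i, ∀ s ∈ R i, B i ≤ B a + B (a + 1) + B m + D (a + 1) + 1 →
      ¬ B a + B (a + 1) + B m + D (a + 1) + 1 < s.1 := fun i s hs hi => by
    have := hB i s hs; omega
  refine ⟨k, D, B a + B (a + 1) + B m + D (a + 1) + 1, ⟨h.pos, ?_, ?_, ?_, ?_⟩, ?_⟩
  · intro i hi s hs
    rw [h.rig i hi s hs, if_neg, if_neg]
    · rfl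
    · rintro ⟨rfl, h'⟩; exact hP _ s hs (by omega) h'
    · rintro ⟨hia, h'⟩
      obtain rfl : i = a := by omega
      exact hP _ s hs (by omega) h'
  · intro i hi c hc
    have h1 := h.interlace i hi c hc
    split_ifs with hif
    · obtain ⟨hia, rfl⟩ := hif
      have : colHt (R (i + 1)) (B a + B (a + 1) + B m + D (a + 1) + 1 + 1) = 0 :=
        colHt_eq_zero.mpr fun s hs => by
          rw [hia] at hs
          have := hB _ s hs; omega
      omega
    · omega
  · intro _ s hs
    rw [if_neg, add_zero]
    · exact htop s hs
    · rintro ⟨-, h'⟩; exact hP _ s hs (by omega) h'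
  · intro _ hk
    exact ⟨(hprev hk).1, (hprev hk).2, by omega⟩
  · intro s hs
    have := hB _ s hs; omega

/-- The configuration reached when `f_a, …, f_{b-1}` have acted. -/
noncomputable def partialAct (a b : ℕ) (R : RC) : RC := fList (List.range' a (b - a)) R

/-- The length of the string that `f_b` lengthens when `(a, …, b)` acts on `R`. -/
noncomputable def actLen (a b : ℕ) (R : RC) : ℕ := selCol b (partialAct a b R) - 1

lemma partialAct_self (a : ℕ) (R : RC) : partialAct a a R = R := by
  simp [partialAct, fList]

lemma partialAct_succ {a b : ℕ} (h : a ≤ b) (R : RC) :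
    partialAct a (b + 1) R = fOp b (partialAct a b R) := by
  rw [partialAct, Nat.sub_add_comm h, List.range'_1_concat, fList, List.foldl_append]
  simp only [List.foldl_cons, List.foldl_nil, Nat.add_sub_cancel' h]
  rfl

lemma fList_lowerInt (a b : ℕ) (R : RC) : fList (lowerInt a b) R = partialAct a (b + 1) R := rfl

/-- The state reached inside the action of `(a, …, m)` on `R`, just before `f_b` acts. -/
structure ActState (a m k : ℕ) (D : ℕ → ℕ) (R : RC) (b P : ℕ) : Prop where
  mid : MidState m b P k D (partialAct a b R)
  bound_head : b = a → ∀ s ∈ R a, s.1 ≤ P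
  eq_prev : ∀ i, a ≤ i → b = i + 1 → P = actLen a i R
  colHt_eq : ∀ i c, 1 ≤ c → colHt (partialAct a b R i) c =
    colHt (R i) c + if a ≤ i ∧ i < b ∧ c = actLen a i R + 1 then 1 else 0

lemma ActState.exists_selects {a m k : ℕ} {D : ℕ → ℕ} {R : RC} {b P : ℕ}
    (h : ActState a m k D R b P) (hb : b ≤ m) :
    ∃ x, Selects (partialAct a b R b) (actLen a b R) x ∧ actLen a b R ≤ P ∧
      (∀ s ∈ partialAct a b R b, s.1 ≤ P → s.1 ≤ actLen a b R) ∧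
      (0 < k → D b < actLen a b R) ∧
      (actLen a b R = 0 ∨ ∃ s ∈ partialAct a b R b, s.1 = actLen a b R) ∧
      x = if b = m then -(k : ℤ) else 0 := by
  obtain ⟨L, x, hsel, hrest⟩ := h.mid.exists_selects hb
  have hL : actLen a b R = L := by rw [actLen, hsel.selCol_eq, Nat.add_sub_cancel]
  rw [hL]
  exact ⟨x, hsel, hrest⟩

lemma ActState.succ {a m k : ℕ} {D : ℕ → ℕ} {R : RC} {b P : ℕ}
    (h : ActState a m k D R b P) (hab : a ≤ b) (hb : b ≤ m) :
    ActState a m k D R (b + 1) (actLen a b R) := by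
  obtain ⟨x, hsel, hLP, hgap, hDL, -, hx⟩ := h.exists_selects hb
  refine ⟨?_, fun h' => by omega, fun i _ hi => ?_, fun i c hc => ?_⟩
  · rw [partialAct_succ hab]
    exact h.mid.step hb hsel hLP hgap hDL hx
  · rw [show b = i by omega]
  · rw [partialAct_succ hab, hsel.colHt_fOp i hc, h.colHt_eq i c hc, add_assoc]
    congr 1
    by_cases hib : i = b
    · subst hib
      simp [hab]
    · have : i < b ↔ i < b + 1 := by omega
      simp [hib, this]

lemma Ready.exists_actState {a m : ℕ} {R : RC} (h : Ready a m R) (ha : 1 ≤ a) (ham : a ≤ m) :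
    ∃ k D, ∀ b, a ≤ b → b ≤ m + 1 → ∃ P, ActState a m k D R b P := by
  obtain ⟨k, D, P, hmid, hP⟩ := h.exists_midState ha ham
  refine ⟨k, D, fun b hab => ?_⟩
  induction b, hab using Nat.le_induction with
  | base =>
    refine fun _ => ⟨P, by rwa [partialAct_self], fun _ => hP, fun i _ _ => by omega,
      fun i c _ => ?_⟩
    rw [partialAct_self, if_neg (by omega), add_zero]
  | succ b hab ih =>
    intro hb
    obtain ⟨P, hP⟩ := ih (by omega)
    exact ⟨_, hP.succ hab (by omega)⟩

/-- The first row of the `a`-th partition is lengthened. -/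
lemma Ready.actLen_head {a m : ℕ} {R : RC} (h : Ready a m R) (ha : 1 ≤ a) (ham : a ≤ m) :
    colHt (R a) (actLen a a R + 1) = 0 ∧
      (actLen a a R = 0 ∨ 0 < colHt (R a) (actLen a a R)) := by
  obtain ⟨k, D, hst⟩ := h.exists_actState ha ham
  obtain ⟨P, hP⟩ := hst a le_rfl (by omega)
  obtain ⟨x, -, -, hgap, -, hex, -⟩ := hP.exists_selects ham
  have hbound := hP.bound_head rfl
  simp only [partialAct_self] at hgap hex
  refine ⟨colHt_eq_zero.mpr fun s hs => Nat.lt_succ_of_le (hgap s hs (hbound s hs)), ?_⟩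
  refine hex.imp_right fun ⟨s, hs, hsL⟩ => ?_
  by_contra hcon
  have := colHt_eq_zero.mp (Nat.eq_zero_of_not_pos hcon) s hs
  omega

/-- In the partition `i + 1` the longest row not longer than the row lengthened in the
partition `i` is lengthened. -/
lemma Ready.actLen_succ {a m : ℕ} {R : RC} (h : Ready a m R) (ha : 1 ≤ a) {i : ℕ}
    (hai : a ≤ i) (him : i < m) : actLen a (i + 1) R ≤ actLen a i R ∧
      colHt (R (i + 1)) (actLen a (i + 1) R + 1) = colHt (R (i + 1)) (actLen a i R + 1) := by
  obtain ⟨k, D, hst⟩ := h.exists_actState ha (by omega)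
  obtain ⟨P, hP⟩ := hst (i + 1) (by omega) (by omega)
  obtain ⟨x, -, hLP, hgap, -⟩ := hP.exists_selects him
  obtain rfl := hP.eq_prev i hai rfl
  refine ⟨hLP, ?_⟩
  have h1 := hP.colHt_eq (i + 1) (actLen a (i + 1) R + 1) (by omega)
  have h2 := hP.colHt_eq (i + 1) (actLen a i R + 1) (by omega)
  rw [if_neg (by omega), add_zero] at h1 h2
  rw [← h1, ← h2]
  exact colHt_congr fun t ht => by have := hgap t ht; omega

lemma Ready.colHt_partialAct {a m : ℕ} {R : RC} (h : Ready a m R) (ha : 1 ≤ a) (ham : a ≤ m)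
    {b : ℕ} (hab : a ≤ b) (hb : b ≤ m + 1) (i : ℕ) {c : ℕ} (hc : 1 ≤ c) :
    colHt (partialAct a b R i) c =
      colHt (R i) c + if a ≤ i ∧ i < b ∧ c = actLen a i R + 1 then 1 else 0 := by
  obtain ⟨k, D, hst⟩ := h.exists_actState ha ham
  obtain ⟨P, hP⟩ := hst b hab hb
  exact hP.colHt_eq i c hc

lemma Ready.selCol_partialAct {a m : ℕ} {R : RC} (h : Ready a m R) (ha : 1 ≤ a)
    {b : ℕ} (hab : a ≤ b) (hb : b ≤ m) :
    selCol b (partialAct a b R) = actLen a b R + 1 := by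
  obtain ⟨k, D, hst⟩ := h.exists_actState ha (hab.trans hb)
  obtain ⟨P, hP⟩ := hst b hab (by omega)
  obtain ⟨x, hsel, -⟩ := hP.exists_selects hb
  exact hsel.selCol_eq

/-- Acting with a lower subinterval prepares the action of the next one. -/
lemma Ready.next {a m a' m' : ℕ} {R : RC} (h : Ready a m R) (ha : 1 ≤ a) (ham : a ≤ m)
    (hcasc : CascCh (a, m) (a', m')) : Ready a' m' (partialAct a (m + 1) R) := by
  obtain ⟨k, D, hst⟩ := h.exists_actState ha ham
  obtain ⟨P, hP⟩ := hst m ham (by omega)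
  obtain ⟨P', hP'⟩ := hst (m + 1) (by omega) le_rfl
  obtain ⟨x, hsel, hLP, hgap, hDL, -, hx⟩ := hP.exists_selects le_rfl
  have hm' : m' ≤ m := by rcases hcasc with h | h <;> simp at h <;> omega
  have hrig : ∀ i < m, ∀ s ∈ partialAct a (m + 1) R i, s.2 = 0 := fun i hi s hs => by
    have := hP'.mid.rig i hi s hs
    split_ifs at this <;> omega
  refine ⟨hP'.mid.pos, fun i hi => hrig i (by omega), fun i hi c hc => ?_, ?_⟩
  · have := hP'.mid.interlace i (by omega) c hc
    split_ifs at this <;> omega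
  · rcases hcasc with hlt | ⟨heq, hle⟩
    · refine ⟨0, fun _ => 0, fun s hs => ?_, fun h0 => h0.false.elim⟩
      have h1 := hP'.mid.pos m' s hs
      have h2 := hrig m' hlt s hs
      exact ⟨fun _ => by simpa using h2, fun h3 => by simp only at h3; omega⟩
    · simp only at heq hle
      subst heq
      refine ⟨k + 1, fun i => actLen a i R, ?_, fun _ => ⟨fun i hi him => ?_, fun i hi him => ?_⟩⟩
      · rw [partialAct_succ ham]
        rw [if_pos rfl] at hx
        subst hx
        exact hP.mid.top_step hsel hLP hgap hDL
      · simp only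
        rw [h.colHt_partialAct ha ham (by omega) le_rfl i (by omega),
          h.colHt_partialAct ha ham (by omega) le_rfl i (by omega), if_neg (by omega),
          if_pos ⟨by omega, by omega, rfl⟩]
        have := colHt_antitone (R i) (show actLen a i R + 1 ≤ actLen a i R + 2 by omega)
        omega
      · exact (h.actLen_succ ha (by omega) him).1

/-! ### Lyndon sequences -/

/-- The number of lower subintervals with head `j` among `I_1, …, I_k`. -/
def headCount (ivs : List (ℕ × ℕ)) (k j : ℕ) : ℕ :=
  (ivs.take k).countP (fun p => decide (p.1 = j))

lemma headCount_succ {ivs : List (ℕ × ℕ)} {k : ℕ} (hk : k < ivs.length) (j : ℕ) :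
    headCount ivs (k + 1) j = headCount ivs k j + if ivs[k].1 = j then 1 else 0 := by
  rw [headCount, headCount, List.take_succ_eq_append_getElem hk, List.countP_append]
  simp [List.countP_singleton]

lemma Rk_succ {ivs : List (ℕ × ℕ)} {k : ℕ} (hk : k < ivs.length) :
    Rk ivs (k + 1) = partialAct ivs[k].1 (ivs[k].2 + 1) (Rk ivs k) := by
  rw [← fList_lowerInt, Rk, Rk, RCseq, RCseq, List.take_succ_eq_append_getElem hk]
  simp only [seqOf, fList, List.map_append, List.flatten_append, List.foldl_append,
    List.map_cons, List.map_nil, List.flatten_cons, List.flatten_nil, List.append_nil]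

lemma Rk_zero (ivs : List (ℕ × ℕ)) : Rk ivs 0 = emptyRC := by
  simp [Rk, RCseq, seqOf, fList]

lemma ready_Rk {n : ℕ} {ivs : List (ℕ × ℕ)} (hc : IsCascDecomp n ivs) {k : ℕ}
    (hk : k < ivs.length) : Ready ivs[k].1 ivs[k].2 (Rk ivs k) := by
  induction k with
  | zero => rw [Rk_zero]; exact ready_emptyRC _ _
  | succ k ih =>
    have hk' : k < ivs.length := by omega
    have hiv := hc.1 ivs[k] (List.getElem_mem hk')
    rw [Rk_succ hk']
    exact (ih hk').next hiv.1 hiv.2.1 (List.isChain_iff_getElem.mp hc.2 k hk)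

/-- For monotone row lengths, adding to the heights `#{i ≤ b : c ≤ N i}` a box in column
`N j + 1` amounts to increasing `N j` by one. -/
lemma card_filter_le_update {N N' : ℕ → ℕ} {j b c : ℕ} (hj : 1 ≤ j) (hjb : j ≤ b)
    (hN : ∀ i, N' i = N i + if j = i then 1 else 0) :
    ((Finset.Icc 1 b).filter fun i => c ≤ N' i).card =
      ((Finset.Icc 1 b).filter fun i => c ≤ N i).card + if c = N j + 1 then 1 else 0 := by
  have hmem : j ∈ Finset.Icc 1 b := Finset.mem_Icc.mpr ⟨hj, hjb⟩
  simp only [Finset.card_filter]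
  rw [← Finset.add_sum_erase _ _ hmem, ← Finset.add_sum_erase _ _ hmem]
  have : ∀ i ∈ (Finset.Icc 1 b).erase j,
      (if c ≤ N' i then 1 else 0) = if c ≤ N i then 1 else 0 := fun i hi => by
    rw [hN, if_neg (Finset.ne_of_mem_erase hi).symm, add_zero]
  rw [Finset.sum_congr rfl this, hN j, if_pos rfl]
  split_ifs <;> omega

lemma headCount_lt {ivs : List (ℕ × ℕ)} {l : ℕ} (hlyn : ∀ l'', l'' ≤ l → LyndonProp ivs l'')
    {k : ℕ} (hk : k < ivs.length) {i : ℕ} (hi : ivs[k].1 < i) (hil : i ≤ l) :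
    headCount ivs k ivs[k].1 < headCount ivs k i := by
  have h : headCount ivs (k + 1) ivs[k].1 ≤ headCount ivs (k + 1) i :=
    hlyn i hil (k + 1) hk _ hi
  rw [headCount_succ hk, headCount_succ hk, if_pos rfl, if_neg (by omega)] at h
  omega

/-- If the partitions `b ≤ l` have rows `N b ≥ N (b - 1) ≥ ⋯ ≥ N 1`, where `N` counts the heads,
then the next lower subinterval lengthens rows of length `N j` only, `j` being its head. -/
lemma actLen_eq_headCount {n : ℕ} {ivs : List (ℕ × ℕ)} (hc : IsCascDecomp n ivs) {l : ℕ}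
    (hlyn : ∀ l'', l'' ≤ l → LyndonProp ivs l'') {k : ℕ} (hk : k < ivs.length)
    (hsh : ∀ b, b ≤ ivs[k].2 → b ≤ l → ∀ c, 1 ≤ c → colHt (Rk ivs k b) c =
      ((Finset.Icc 1 b).filter fun i => c ≤ headCount ivs k i).card)
    {b : ℕ} (hjb : ivs[k].1 ≤ b) (hbm : b ≤ ivs[k].2) (hbl : b ≤ l) :
    actLen ivs[k].1 b (Rk ivs k) = headCount ivs k ivs[k].1 := by
  have hiv := hc.1 ivs[k] (List.getElem_mem hk)
  have hready := ready_Rk hc hk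
  -- a row of length `N j` is present in the partition `b`
  have hlt : ∀ b, ivs[k].1 ≤ b → b ≤ ivs[k].2 → b ≤ l → 1 ≤ headCount ivs k ivs[k].1 →
      colHt (Rk ivs k b) (headCount ivs k ivs[k].1 + 1) <
        colHt (Rk ivs k b) (headCount ivs k ivs[k].1) := by
    intro b hjb hbm hbl hpos
    rw [hsh b hbm hbl _ (by omega), hsh b hbm hbl _ hpos]
    apply Finset.card_lt_card
    rw [Finset.ssubset_iff_of_subset
      (Finset.monotone_filter_right _ fun i _ h => (Nat.le_succ _).trans h)]
    exact ⟨ivs[k].1, by simp [hiv.1, hjb], by simp⟩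
  induction b, hjb using Nat.le_induction with
  | base =>
    obtain ⟨h0, h1⟩ := hready.actLen_head hiv.1 hiv.2.1
    have htop : colHt (Rk ivs k ivs[k].1) (headCount ivs k ivs[k].1 + 1) = 0 := by
      rw [hsh _ hbm hbl _ (by omega), Finset.card_eq_zero, Finset.filter_eq_empty_iff]
      intro i hi
      rw [Finset.mem_Icc] at hi
      rcases hi.2.eq_or_lt with rfl | hij
      · omega
      · have : headCount ivs k i ≤ headCount ivs k ivs[k].1 := hlyn _ hbl k hk.le i hij
        omega
    apply le_antisymm
    · by_contra! hcon
      have := colHt_antitone (Rk ivs k ivs[k].1) (Nat.succ_le_of_lt hcon)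
      simp only [Nat.succ_eq_add_one] at this
      omega
    · by_contra! hcon
      have h2 := hlt _ le_rfl hbm hbl (by omega)
      have := colHt_antitone (Rk ivs k ivs[k].1) (Nat.succ_le_of_lt hcon)
      simp only [Nat.succ_eq_add_one] at this
      omega
  | succ b hjb ih =>
    obtain ⟨h0, h1⟩ := hready.actLen_succ hiv.1 hjb hbm
    rw [ih (by omega) (by omega)] at h0 h1
    apply le_antisymm h0
    by_contra! hcon
    have h2 := hlt (b + 1) (by omega) hbm hbl (by omega)
    have := colHt_antitone (Rk ivs k (b + 1)) (Nat.succ_le_of_lt hcon)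
    simp only [Nat.succ_eq_add_one] at this
    omega

/-- The rows of the `b`-th partition are the numbers of heads `b, b - 1, …, 1`. -/
lemma colHt_Rk {n : ℕ} {ivs : List (ℕ × ℕ)} (hc : IsCascDecomp n ivs) {l : ℕ}
    (hlyn : ∀ l'', l'' ≤ l → LyndonProp ivs l'') {k : ℕ} (hk : k < ivs.length) :
    ∀ b, b ≤ ivs[k].2 → b ≤ l → ∀ c, 1 ≤ c → colHt (Rk ivs k b) c =
      ((Finset.Icc 1 b).filter fun i => c ≤ headCount ivs k i).card := by
  induction k with
  | zero =>
    intro b _ _ c hc1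
    have : ∀ i, ¬ c ≤ headCount ivs 0 i := fun i => by simp [headCount]; omega
    simp [Rk_zero, emptyRC, colHt, this]
  | succ k ih =>
    intro b hbm hbl c hc1
    have hk' : k < ivs.length := by omega
    have hsh := ih hk'
    have hiv := hc.1 ivs[k] (List.getElem_mem hk')
    have hbm' : b ≤ ivs[k].2 := by
      have : CascCh ivs[k] ivs[k + 1] := List.isChain_iff_getElem.mp hc.2 k hk
      unfold CascCh at this
      omega
    rw [Rk_succ hk', (ready_Rk hc hk').colHt_partialAct hiv.1 hiv.2.1
      (by have := hiv.2.1; omega) le_rfl b hc1, hsh b hbm' hbl c hc1]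
    by_cases hjb : ivs[k].1 ≤ b
    · rw [actLen_eq_headCount hc hlyn hk' hsh hjb hbm' hbl,
        card_filter_le_update hiv.1 hjb (fun i => headCount_succ hk' i)]
      simp [hjb, Nat.lt_succ_of_le hbm']
    · rw [if_neg (by omega), add_zero]
      congr 1
      apply Finset.filter_congr
      intro i hi
      rw [Finset.mem_Icc] at hi
      rw [headCount_succ hk', if_neg (by omega), add_zero]

/-- Lemma "lyndonimplies".
Suppose the cascading `n`-sequence satisfies the Lyndon property for every letter
`≤ l`.  If `I_{k+1}` (0-based `k`) has head `j ≤ l` and maximum `m`, then there is a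
single column index `c` such that for every `j ≤ l' ≤ min m l`, the operator `f_{l'}`
occurring in `I_{k+1}` adds a box to column `c` of the `l'`-th partition (it replaces
a string of length `c - 1` by one of length `c`), and this box has height
`l' - j + 1` (the resulting `l'`-th partition has exactly `l' - j + 1` strings of
length at least `c`). -/
theorem lyndon_implies (n : ℕ) (hn : 0 < n)
    (ivs : List (ℕ × ℕ)) (hc : IsCascDecomp n ivs)
    (l : ℕ) (hlyn : ∀ l'', l'' ≤ l → LyndonProp ivs l'')
    (k : ℕ) (hk : k < ivs.length) (j m : ℕ)
    (hj : (ivs[k]'hk).1 = j) (hm : (ivs[k]'hk).2 = m) (hjl : j ≤ l) :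
    ∃ c, 1 ≤ c ∧ ∀ l', j ≤ l' → l' ≤ m → l' ≤ l →
      ivCol (j, m) l' (Rk ivs k) = c ∧
      colHt (fList (lowerInt j l') (Rk ivs k) l') c = l' - j + 1 := by
  subst hj hm
  have hiv := hc.1 ivs[k] (List.getElem_mem hk)
  have hready := ready_Rk hc hk
  have hsh := colHt_Rk hc hlyn hk
  refine ⟨headCount ivs k ivs[k].1 + 1, by omega, fun b hjb hbm hbl => ?_⟩
  have hL := actLen_eq_headCount hc hlyn hk hsh hjb hbm hbl
  have hcol : colHt (Rk ivs k b) (headCount ivs k ivs[k].1 + 1) = b - ivs[k].1 := by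
    rw [hsh b hbm hbl _ (by omega), ← Nat.card_Ioc]
    congr 1
    ext i
    simp only [Finset.mem_filter, Finset.mem_Icc, Finset.mem_Ioc]
    constructor
    · rintro ⟨⟨-, hib⟩, hi⟩
      refine ⟨?_, hib⟩
      by_contra! hcon
      rcases hcon.eq_or_lt with rfl | hlt
      · omega
      · have : headCount ivs k i ≤ headCount ivs k ivs[k].1 := hlyn _ hjl k hk.le i hlt
        omega
    · rintro ⟨hji, hib⟩
      exact ⟨⟨by omega, hib⟩, headCount_lt hlyn hk hji (by omega)⟩
  constructor
  · have h := hready.selCol_partialAct hiv.1 hjb hbm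
    rw [hL] at h
    rw [ivCol, fList_lowerInt, Nat.sub_add_cancel (hiv.1.trans hjb)]
    exact h
  · rw [fList_lowerInt, hready.colHt_partialAct hiv.1 hiv.2.1 (by omega) (by omega) b
      (by omega), hcol, if_pos ⟨hjb, by omega, by rw [hL]⟩]

end CascRC
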